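/- arXiv:2009.14150 — 2 statements merged into one kernel-verified Lean document; each statement's English description precedes it below -/
import Mathlib

section
/- Let (X, d_X) and (Y, d_Y) be separable metric spaces of strong negative type. Then for every Borel probability measure θ on X × Y whose marginals μ, ν have finite first moments, the distance covariance dcov(θ) is nonnegative and dcov(θ) = 0 if and only if θ = μ × ν. In particular, for random elements X ∼ μ and Y ∼ ν with joint distribution θ, dcov(X,Y) = 0 if and only if X and Y are independent. -/
open MeasureTheory

/-- A metric space has negative type if its metric is conditionally negative
definite. -/
def NegativeType (X : Type*) [MetricSpace X] : Prop :=
  ∀ n : ℕ, 1 ≤ n → ∀ x : Fin n → X, ∀ α : Fin n → ℝ, (∑ i : Fin n, α i) = 0 →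
    ∑ i : Fin n, ∑ j : Fin n, α i * α j * dist (x i) (x j) ≤ 0

/-- The expected distance `a_μ(x) := ∫ d(x,x') dμ(x')`. -/
noncomputable def expectedDist {X : Type*} [MetricSpace X] [MeasurableSpace X]
    (μ : Measure X) (x : X) : ℝ :=
  ∫ x', dist x x' ∂μ

/-- `D(μ) := ∫∫ d(x,x') dμ(x) dμ(x')`. -/
noncomputable def measureD {X : Type*} [MetricSpace X] [MeasurableSpace X]
    (μ : Measure X) : ℝ :=
  ∫ x, ∫ x', dist x x' ∂μ ∂μ

/-- A metric space has strong negative type if it has negative type and the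
operator `D` separates Borel probability measures with finite first moments:
`D(μ₁ − μ₂) = 0` implies `μ₁ = μ₂`. -/
def StrongNegativeType (X : Type*) [MetricSpace X] [MeasurableSpace X] : Prop :=
  NegativeType X ∧
    ∀ μ₁ μ₂ : Measure X, IsProbabilityMeasure μ₁ → IsProbabilityMeasure μ₂ →
      (∃ o : X, Integrable (fun x => dist o x) μ₁) →
      (∃ o : X, Integrable (fun x => dist o x) μ₂) →
      measureD μ₁ + measureD μ₂ - 2 * (∫ x, ∫ x', dist x x' ∂μ₂ ∂μ₁) = 0 →
      μ₁ = μ₂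

/-- The doubly centred distance `d_μ(x₁,x₂) := d(x₁,x₂) − a_μ(x₁) − a_μ(x₂) + D(μ)`. -/
noncomputable def centredDist {X : Type*} [MetricSpace X] [MeasurableSpace X]
    (μ : Measure X) (x₁ x₂ : X) : ℝ :=
  dist x₁ x₂ - expectedDist μ x₁ - expectedDist μ x₂ + measureD μ

/-- The distance covariance
`dcov(θ) := ∫∫ d_μ(x,x')·d_ν(y,y') dθ((x,y)) dθ((x',y'))`, where `μ, ν` are the
marginals of `θ`. -/
noncomputable def dcov {X Y : Type*} [MetricSpace X] [MetricSpace Y]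
    [MeasurableSpace X] [MeasurableSpace Y] (θ : Measure (X × Y)) : ℝ :=
  ∫ p : (X × Y) × (X × Y),
    centredDist (θ.map Prod.fst) p.1.1 p.2.1 * centredDist (θ.map Prod.snd) p.1.2 p.2.2
    ∂(θ.prod θ)

open scoped TensorProduct InnerProductSpace

universe u v

theorem NegativeType.exists_kernel_embedding {X : Type u} [MetricSpace X] (hX : NegativeType X)
    (o : X) :
    ∃ (H : Type u) (_ : NormedAddCommGroup H) (_ : InnerProductSpace ℝ H) (_ : CompleteSpace H)
      (φ : X → H), ∀ x x', ⟪φ x, φ x'⟫_ℝ = dist o x + dist o x' - dist x x' := by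
  let K : Matrix X X (ℝ →L[ℝ] ℝ) := .of fun x x' ↦
    (dist o x + dist o x' - dist x x') • ContinuousLinearMap.id ℝ ℝ
  have hherm : K.IsHermitian := by
    ext x x'
    simp [K, Matrix.conjTranspose_apply, dist_comm, add_comm, ContinuousLinearMap.star_eq_adjoint,
      ContinuousLinearMap.adjoint_id]
  have hpos : K.PosSemidef := by
    have hiff := (RKHS.posSemidef_tfae (K := K)).out 0 2
    refine hiff.mpr ⟨hherm, fun v ↦ ?_⟩
    let e := v.support.equivFin
    have h := hX (v.support.card + 1) (by omega)
      (Fin.cons o fun i ↦ (e.symm i : X))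
      (Fin.cons (-∑ i, v (e.symm i)) fun i ↦ v (e.symm i))
      (by simp [Fin.sum_univ_succ])
    have hsum (F : X → ℝ) : ∑ x ∈ v.support, F x = ∑ i, F (e.symm i) := by
      rw [← Finset.sum_coe_sort, ← e.symm.sum_comp]
    simp only [Finsupp.sum, hsum, K, Matrix.of_apply]
    simp only [Fin.sum_univ_succ, Fin.cons_zero, Fin.cons_succ, dist_self] at h
    simp [Finset.sum_add_distrib] at h ⊢
    refine (sub_nonneg.mpr h).trans_eq ?_
    simp_rw [Finset.mul_sum, Finset.sum_mul]
    rw [add_comm, Finset.sum_comm, ← Finset.sum_add_distrib, ← Finset.sum_sub_distrib]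
    refine Finset.sum_congr rfl fun i _ ↦ ?_
    rw [← Finset.sum_add_distrib, ← Finset.sum_sub_distrib]
    refine Finset.sum_congr rfl fun j _ ↦ ?_
    rw [dist_comm _ o, dist_comm (e.symm j : X)]
    ring
  have : Fact K.PosSemidef := ⟨hpos⟩
  refine ⟨RKHS.OfKernel K, inferInstance, inferInstance, inferInstance,
    fun x ↦ RKHS.kerFun (RKHS.OfKernel K) x 1, fun x x' ↦ ?_⟩
  rw [← RKHS.kernel_inner, RKHS.OfKernel.kernel_ofKernel]
  simp [K, dist_comm, add_comm]

theorem integrable_dist_of_exists {X : Type*} [MetricSpace X] [MeasurableSpace X] [BorelSpace X]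
    [TopologicalSpace.SeparableSpace X] {μ : Measure X} [IsFiniteMeasure μ]
    (hμ : ∃ o : X, Integrable (fun x ↦ dist o x) μ) (x : X) :
    Integrable (fun x' ↦ dist x x') μ := by
  obtain ⟨o, ho⟩ := hμ
  have := UniformSpace.secondCountable_of_separable X
  refine Integrable.mono' (ho.add (integrable_const (dist x o)))
    (by fun_prop) (.of_forall fun x' ↦ ?_)
  rw [Real.norm_of_nonneg dist_nonneg]
  simpa [add_comm] using dist_triangle x o x'

section

variable {X : Type u} [MetricSpace X] [MeasurableSpace X] [BorelSpace X]
    [TopologicalSpace.SeparableSpace X]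

theorem abs_dist_sub_expectedDist_le {μ : Measure X} [IsProbabilityMeasure μ]
    (hμ : ∃ o : X, Integrable (fun x ↦ dist o x) μ) (x x' : X) :
    |dist x x' - expectedDist μ x| ≤ expectedDist μ x' := by
  have h : dist x x' - expectedDist μ x = ∫ z, (dist x x' - dist x z) ∂μ := by
    rw [integral_sub (integrable_const _) (integrable_dist_of_exists hμ x)]
    simp [expectedDist]
  rw [h, ← Real.norm_eq_abs]
  refine norm_integral_le_of_norm_le (integrable_dist_of_exists hμ x') (.of_forall fun z ↦ ?_)
  rw [Real.norm_eq_abs, abs_le]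
  constructor
  · linarith [dist_triangle x x' z]
  · linarith [dist_triangle x z x', dist_comm z x']

theorem abs_centredDist_le {μ : Measure X} [IsProbabilityMeasure μ]
    (hμ : ∃ o : X, Integrable (fun x ↦ dist o x) μ) (x x' : X) :
    |centredDist μ x x'| ≤ 2 * expectedDist μ x' + |measureD μ| := by
  have h := abs_le.mp (abs_dist_sub_expectedDist_le hμ x x')
  have h' := abs_le.mp (le_refl |measureD μ|)
  rw [centredDist, abs_le]
  constructor <;> linarith

theorem continuous_expectedDist {μ : Measure X} [IsProbabilityMeasure μ]
    (hμ : ∃ o : X, Integrable (fun x ↦ dist o x) μ) : Continuous (expectedDist μ) := by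
  refine (LipschitzWith.of_dist_le_mul (K := 1) fun x x' ↦ ?_).continuous
  have h0 : ∫ z, (dist x z - dist x' z) ∂μ = expectedDist μ x - expectedDist μ x' :=
    integral_sub (integrable_dist_of_exists hμ x) (integrable_dist_of_exists hμ x')
  rw [Real.dist_eq, ← h0, ← Real.norm_eq_abs]
  refine (norm_integral_le_of_norm_le_const (.of_forall fun z ↦ ?_)).trans
    (b := dist x x' * μ.real Set.univ) (by simp)
  rw [Real.norm_eq_abs]
  exact abs_dist_sub_le x x' z

theorem continuous_centredDist_left {μ : Measure X} [IsProbabilityMeasure μ]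
    (hμ : ∃ o : X, Integrable (fun x ↦ dist o x) μ) (x' : X) :
    Continuous fun x ↦ centredDist μ x x' := by
  have := continuous_expectedDist hμ
  unfold centredDist
  fun_prop

theorem integrable_expectedDist {μ ν : Measure X} [IsProbabilityMeasure μ] [IsFiniteMeasure ν]
    (hμ : ∃ o : X, Integrable (fun x ↦ dist o x) μ)
    (hν : ∃ o : X, Integrable (fun x ↦ dist o x) ν) : Integrable (expectedDist μ) ν := by
  have := UniformSpace.secondCountable_of_separable X
  obtain ⟨o, ho⟩ := hν
  refine Integrable.mono' (ho.add (integrable_const (expectedDist μ o)))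
    (continuous_expectedDist hμ).aestronglyMeasurable (.of_forall fun x ↦ ?_)
  have h0 : 0 ≤ expectedDist μ x := integral_nonneg fun _ ↦ dist_nonneg
  have := abs_le.mp (abs_dist_sub_expectedDist_le hμ x o)
  rw [Real.norm_of_nonneg h0]
  simp only [Pi.add_apply]
  linarith [dist_comm x o]

theorem integral_centredDist_left {μ : Measure X} [IsProbabilityMeasure μ]
    (hμ : ∃ o : X, Integrable (fun x ↦ dist o x) μ) (x' : X) :
    ∫ x, centredDist μ x x' ∂μ = 0 := by
  have h1 := integrable_dist_of_exists hμ x'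
  have h2 := integrable_expectedDist hμ hμ
  simp_rw [centredDist, dist_comm _ x']
  rw [integral_add (by fun_prop) (by fun_prop), integral_sub (by fun_prop) (by fun_prop),
    integral_sub h1 h2]
  simp [measureD, expectedDist]

theorem integral_expectedDist_comm {μ ν : Measure X} [IsProbabilityMeasure μ]
    [IsProbabilityMeasure ν] (hμ : ∃ o : X, Integrable (fun x ↦ dist o x) μ)
    (hν : ∃ o : X, Integrable (fun x ↦ dist o x) ν) :
    ∫ x, expectedDist μ x ∂ν = ∫ x, expectedDist ν x ∂μ := by
  have := UniformSpace.secondCountable_of_separable X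
  obtain ⟨o, ho⟩ := hμ
  have ho' := integrable_dist_of_exists hν o
  simp only [expectedDist]
  rw [integral_integral_swap]
  · simp_rw [dist_comm]
  · refine Integrable.mono' ((ho'.comp_fst μ).add (ho.comp_snd ν))
      (by fun_prop) (.of_forall fun x ↦ ?_)
    simpa [Function.uncurry, abs_of_nonneg, dist_comm o x.1] using dist_triangle x.1 o x.2

theorem StrongNegativeType.eq_of_expectedDist_eq_add_const (hX : StrongNegativeType X)
    {μ ν : Measure X} [IsProbabilityMeasure μ] [IsProbabilityMeasure ν]
    (hμ : ∃ o : X, Integrable (fun x ↦ dist o x) μ)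
    (hν : ∃ o : X, Integrable (fun x ↦ dist o x) ν) (c : ℝ)
    (h : ∀ x, expectedDist μ x = expectedDist ν x + c) : μ = ν := by
  refine hX.2 μ ν inferInstance inferInstance hμ hν ?_
  have h1 : measureD μ = ∫ x, expectedDist ν x ∂μ + c := by
    change ∫ x, expectedDist μ x ∂μ = _
    simp_rw [h]
    rw [integral_add (integrable_expectedDist hν hμ) (integrable_const _)]
    simp
  have h2 : ∫ x, expectedDist μ x ∂ν = measureD ν + c := by
    simp_rw [h]
    rw [integral_add (integrable_expectedDist hν hν) (integrable_const _)]
    simp [measureD, expectedDist]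
  have h3 := integral_expectedDist_comm hμ hν
  change _ + _ - 2 * ∫ x, expectedDist ν x ∂μ = 0
  linarith

theorem StrongNegativeType.setIntegral_preimage_eq_zero (hX : StrongNegativeType X)
    {Ω : Type*} [MeasurableSpace Ω] {P : Measure Ω} [IsProbabilityMeasure P]
    {f : Ω → X} (hf : Measurable f) (hμ : ∃ o : X, Integrable (fun x ↦ dist o x) (P.map f))
    {g : Ω → ℝ} (hg : Measurable g) {C : ℝ} (hC : ∀ ω, |g ω| ≤ C) (hg0 : ∫ ω, g ω ∂P = 0)
    (hfg : ∀ x, ∫ ω, centredDist (P.map f) (f ω) x * g ω ∂P = 0)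
    {A : Set X} (hA : MeasurableSet A) : ∫ ω in f ⁻¹' A, g ω ∂P = 0 := by
  have := UniformSpace.secondCountable_of_separable X
  have := Measure.isProbabilityMeasure_map (μ := P) hf.aemeasurable
  obtain ⟨c, hc, hgc⟩ : ∃ c : ℝ, 0 < c ∧ ∀ ω, |c * g ω| ≤ 1 := by
    refine ⟨(|C| + 1)⁻¹, by positivity, fun ω ↦ ?_⟩
    rw [abs_mul, abs_of_pos (by positivity), inv_mul_le_iff₀ (by positivity)]
    linarith [hC ω, le_abs_self C]
  have hgi : Integrable g P :=
    Integrable.of_bound hg.aestronglyMeasurable C (.of_forall hC)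
  let h : Ω → ℝ := fun ω ↦ 1 + c * g ω
  have hh0 (ω) : 0 ≤ h ω := by linarith [(abs_le.mp (hgc ω)).1, show h ω = 1 + c * g ω from rfl]
  have hhi : Integrable h P := by fun_prop
  have hset (s : Set Ω) (hs : MeasurableSet s) :
      P.withDensity (fun ω ↦ ENNReal.ofReal (h ω)) s = ENNReal.ofReal (∫ ω in s, h ω ∂P) := by
    rw [withDensity_apply _ hs, ofReal_integral_eq_lintegral_ofReal hhi.integrableOn
      (.of_forall hh0)]
  have hhint (s : Set Ω) : ∫ ω in s, h ω ∂P = P.real s + c * ∫ ω in s, g ω ∂P := by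
    rw [integral_add (by fun_prop) (hgi.integrableOn.const_mul c), integral_const_mul]
    simp
  let Q := P.withDensity fun ω ↦ ENNReal.ofReal (h ω)
  have hQ : IsProbabilityMeasure Q := ⟨by
    rw [hset _ .univ, hhint]
    simp [hg0]⟩
  have := Measure.isProbabilityMeasure_map (μ := Q) hf.aemeasurable
  have hfi (x : X) : Integrable (fun ω ↦ dist x (f ω)) P :=
    (integrable_dist_of_exists hμ x).comp_measurable hf
  have hfgi (x : X) : Integrable (fun ω ↦ g ω * dist x (f ω)) P :=
    (hfi x).bdd_mul hg.aestronglyMeasurable (.of_forall hC)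
  have hQint (u : Ω → ℝ) : ∫ ω, u ω ∂Q = ∫ ω, h ω * u ω ∂P := by
    rw [integral_withDensity_eq_integral_toReal_smul (by fun_prop) (by simp)]
    simp [ENNReal.toReal_ofReal (hh0 _)]
  have hμ' : ∃ o : X, Integrable (fun x ↦ dist o x) (Q.map f) := by
    obtain ⟨o, -⟩ := hμ
    refine ⟨o, (integrable_map_measure (by fun_prop) hf.aemeasurable).mpr ?_⟩
    rw [integrable_withDensity_iff (by fun_prop) (by simp)]
    refine ((hfi o).add ((hfgi o).const_mul c)).congr (.of_forall fun ω ↦ ?_)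
    simp only [Pi.add_apply, Function.comp_apply, ENNReal.toReal_ofReal (hh0 _), h]
    ring
  have hagi : Integrable (fun ω ↦ expectedDist (P.map f) (f ω)) P :=
    (integrable_expectedDist hμ hμ).comp_measurable hf
  have hagi' : Integrable (fun ω ↦ g ω * expectedDist (P.map f) (f ω)) P :=
    hagi.bdd_mul hg.aestronglyMeasurable (.of_forall hC)
  have heq : Q.map f = P.map f := by
    refine hX.eq_of_expectedDist_eq_add_const hμ' hμ
      (c * ∫ ω, g ω * expectedDist (P.map f) (f ω) ∂P) fun x ↦ ?_
    have h1 : expectedDist (Q.map f) x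
        = expectedDist (P.map f) x + c * ∫ ω, g ω * dist x (f ω) ∂P := by
      rw [expectedDist, expectedDist, integral_map hf.aemeasurable (by fun_prop),
        integral_map hf.aemeasurable (by fun_prop), hQint, ← integral_const_mul,
        ← integral_add (hfi x) ((hfgi x).const_mul c)]
      refine integral_congr_ae (.of_forall fun ω ↦ ?_)
      simp only [h]
      ring
    have h2 : ∫ ω, centredDist (P.map f) (f ω) x * g ω ∂P
        = ∫ ω, g ω * dist x (f ω) ∂P - ∫ ω, g ω * expectedDist (P.map f) (f ω) ∂P
          - (expectedDist (P.map f) x - measureD (P.map f)) * ∫ ω, g ω ∂P := by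
      rw [← integral_const_mul, ← integral_sub (hfgi x) hagi',
        ← integral_sub (by fun_prop) (hgi.const_mul _)]
      refine integral_congr_ae (.of_forall fun ω ↦ ?_)
      simp only [centredDist, dist_comm x]
      ring
    rw [hfg, hg0] at h2
    rw [h1]
    congr 2
    linarith
  have hA' := congrArg (fun m ↦ m A) heq
  simp only [Measure.map_apply hf hA] at hA'
  rw [hset _ (hf hA), ← ofReal_measureReal, ENNReal.ofReal_eq_ofReal_iff
    (integral_nonneg hh0) measureReal_nonneg, hhint] at hA'
  simpa [hc.ne'] using hA'

theorem NegativeType.exists_centred_embedding (hX : NegativeType X) {μ : Measure X}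
    [IsProbabilityMeasure μ] (hμ : ∃ o : X, Integrable (fun x ↦ dist o x) μ) :
    ∃ (H : Type u) (_ : NormedAddCommGroup H) (_ : InnerProductSpace ℝ H) (_ : CompleteSpace H)
      (ψ : X → H), Continuous ψ ∧ MemLp ψ 2 μ ∧ ∫ x, ψ x ∂μ = 0 ∧
        ∀ x x', ⟪ψ x, ψ x'⟫_ℝ = -centredDist μ x x' := by
  have := UniformSpace.secondCountable_of_separable X
  obtain ⟨o, ho⟩ := id hμ
  obtain ⟨H, _, _, _, φ, hφ⟩ := hX.exists_kernel_embedding o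
  have hnorm (x x' : X) : ‖φ x - φ x'‖ ^ 2 = 2 * dist x x' := by
    rw [← real_inner_self_eq_norm_sq, inner_sub_sub_self, hφ, hφ, hφ, hφ]
    simp [dist_comm]
    ring
  have hcont : Continuous φ := by
    rw [continuous_iff_continuousAt]
    intro x
    rw [ContinuousAt, tendsto_iff_norm_sub_tendsto_zero]
    have h0 : Filter.Tendsto (fun x' ↦ √(2 * dist x' x)) (nhds x) (nhds 0) := by
      have : Continuous fun x' ↦ √(2 * dist x' x) := by fun_prop
      simpa using this.tendsto x
    refine h0.congr fun x' ↦ ?_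
    rw [← hnorm, Real.sqrt_sq (norm_nonneg _)]
  have hL2 : MemLp φ 2 μ := by
    rw [memLp_two_iff_integrable_sq_norm hcont.aestronglyMeasurable]
    refine (ho.const_mul 2).congr (.of_forall fun x ↦ ?_)
    simp only [← real_inner_self_eq_norm_sq, hφ, dist_self]
    ring
  have hint : Integrable φ μ := hL2.integrable (by norm_num)
  set m := ∫ x, φ x ∂μ with hm
  have h1 (x : X) : ⟪φ x, m⟫_ℝ = dist o x + expectedDist μ o - expectedDist μ x := by
    rw [hm, ← integral_inner hint]
    simp_rw [hφ]
    rw [integral_sub (by fun_prop) (integrable_dist_of_exists hμ x),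
      integral_add (integrable_const _) ho]
    simp [expectedDist]
  have h2 : ⟪m, m⟫_ℝ = 2 * expectedDist μ o - measureD μ := by
    conv_lhs => rw [hm, real_inner_comm, ← hm, ← integral_inner hint]
    simp_rw [real_inner_comm _ m, h1]
    rw [integral_sub (by fun_prop) (integrable_expectedDist hμ hμ),
      integral_add ho (integrable_const _)]
    simp [expectedDist, measureD]
    ring
  refine ⟨H, _, ‹_›, ‹_›, fun x ↦ φ x - m, by fun_prop, hL2.sub (memLp_const m), ?_,
    fun x x' ↦ ?_⟩
  · rw [integral_sub hint (integrable_const _)]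
    simp [hm]
  · rw [inner_sub_left, inner_sub_right, inner_sub_right, h1, h2, real_inner_comm (φ x') m, h1,
      hφ, centredDist]
    ring

end

theorem NegativeType.exists_tensor_embedding {X : Type u} {Y : Type v} [MetricSpace X] [MetricSpace Y]
    [TopologicalSpace.SeparableSpace X] [TopologicalSpace.SeparableSpace Y]
    [MeasurableSpace X] [BorelSpace X] [MeasurableSpace Y] [BorelSpace Y]
    (hX : NegativeType X) (hY : NegativeType Y)
    (θ : Measure (X × Y)) [IsProbabilityMeasure θ]
    (hμ : ∃ o : X, Integrable (fun x ↦ dist o x) (θ.map Prod.fst))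
    (hν : ∃ o : Y, Integrable (fun y ↦ dist o y) (θ.map Prod.snd)) :
    ∃ (H : Type (max u v)) (_ : NormedAddCommGroup H) (_ : InnerProductSpace ℝ H) (_ : CompleteSpace H)
      (F : X × Y → H), Integrable F θ ∧
        (θ = (θ.map Prod.fst).prod (θ.map Prod.snd) → ∫ p, F p ∂θ = 0) ∧
        ∀ p q, ⟪F p, F q⟫_ℝ =
          centredDist (θ.map Prod.fst) p.1 q.1 * centredDist (θ.map Prod.snd) p.2 q.2 := by
  have := UniformSpace.secondCountable_of_separable X
  have := UniformSpace.secondCountable_of_separable Y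
  have := Measure.isProbabilityMeasure_map (μ := θ) measurable_fst.aemeasurable
  have := Measure.isProbabilityMeasure_map (μ := θ) measurable_snd.aemeasurable
  obtain ⟨H, _, _, _, φ, hφc, hφL, -, hφ⟩ := hX.exists_centred_embedding hμ
  obtain ⟨K, _, _, _, ψ, hψc, hψL, hψ0, hψ⟩ := hY.exists_centred_embedding hν
  let ι : H ⊗[ℝ] K →L[ℝ] UniformSpace.Completion (H ⊗[ℝ] K) := UniformSpace.Completion.toComplL
  let F : X × Y → UniformSpace.Completion (H ⊗[ℝ] K) := fun p ↦ ι (φ p.1 ⊗ₜ ψ p.2)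
  have hF : Continuous F := by fun_prop
  have hFi : Integrable F θ := by
    have h1 : MemLp (fun p : X × Y ↦ ‖φ p.1‖) 2 θ :=
      (hφL.norm.comp_measurePreserving (measurable_fst.measurePreserving θ))
    have h2 : MemLp (fun p : X × Y ↦ ‖ψ p.2‖) 2 θ :=
      (hψL.norm.comp_measurePreserving (measurable_snd.measurePreserving θ))
    refine (h1.integrable_mul h2).mono hF.aestronglyMeasurable (.of_forall fun p ↦ ?_)
    simp [F, ι]
  refine ⟨_, inferInstance, inferInstance, inferInstance, F, hFi, fun hθ ↦ ?_, fun p q ↦ ?_⟩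
  · rw [hθ] at hFi
    rw [hθ, integral_prod _ hFi]
    refine integral_eq_zero_of_ae (.of_forall fun x ↦ ?_)
    let L : K →L[ℝ] UniformSpace.Completion (H ⊗[ℝ] K) := ι ∘L TensorProduct.mkL ℝ H K (φ x)
    change ∫ y, L (ψ y) ∂(θ.map Prod.snd) = 0
    rw [L.integral_comp_comm (hψL.integrable (by norm_num)), hψ0, map_zero]
  · simp [F, ι, hφ, hψ]

theorem integral_inner_prod_self {α H : Type*} [MeasurableSpace α] [NormedAddCommGroup H]
    [InnerProductSpace ℝ H] [CompleteSpace H] {θ : Measure α} [SFinite θ] {F : α → H}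
    (hF : Integrable F θ) :
    ∫ p : α × α, ⟪F p.1, F p.2⟫_ℝ ∂(θ.prod θ) = ‖∫ p, F p ∂θ‖ ^ 2 := by
  have hint : Integrable (fun p : α × α ↦ ⟪F p.1, F p.2⟫_ℝ) (θ.prod θ) :=
    (hF.norm.mul_prod hF.norm).mono (hF.aestronglyMeasurable.comp_fst.inner
      hF.aestronglyMeasurable.comp_snd) (.of_forall fun p ↦ by
        simpa using abs_real_inner_le_norm (F p.1) (F p.2))
  rw [integral_prod _ hint, ← real_inner_self_eq_norm_sq, ← integral_inner hF]
  refine integral_congr_ae (.of_forall fun p ↦ ?_)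
  simp only
  rw [integral_inner hF, real_inner_comm]

theorem eq_prod_of_integral_centredDist_mul_eq_zero {X Y : Type*} [MetricSpace X] [MetricSpace Y]
    [TopologicalSpace.SeparableSpace X] [TopologicalSpace.SeparableSpace Y]
    [MeasurableSpace X] [BorelSpace X] [MeasurableSpace Y] [BorelSpace Y]
    (hX : StrongNegativeType X) (hY : StrongNegativeType Y)
    (θ : Measure (X × Y)) [IsProbabilityMeasure θ]
    (hμ : ∃ o : X, Integrable (fun x ↦ dist o x) (θ.map Prod.fst))
    (hν : ∃ o : Y, Integrable (fun y ↦ dist o y) (θ.map Prod.snd))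
    (h : ∀ q : X × Y, ∫ p, centredDist (θ.map Prod.fst) p.1 q.1 *
      centredDist (θ.map Prod.snd) p.2 q.2 ∂θ = 0) :
    θ = (θ.map Prod.fst).prod (θ.map Prod.snd) := by
  have := Measure.isProbabilityMeasure_map (μ := θ) measurable_fst.aemeasurable
  have := Measure.isProbabilityMeasure_map (μ := θ) measurable_snd.aemeasurable
  have hm (y : Y) : Measurable fun p : X × Y ↦ centredDist (θ.map Prod.snd) p.2 y :=
    (continuous_centredDist_left hν y).measurable.comp measurable_snd
  have h0 (y : Y) : ∫ p, centredDist (θ.map Prod.snd) p.2 y ∂θ = 0 := by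
    rw [← integral_centredDist_left hν y, integral_map measurable_snd.aemeasurable
      (continuous_centredDist_left hν y).aestronglyMeasurable]
  have hb (y : Y) (p : X × Y) := abs_centredDist_le hν p.2 y
  have hi (y : Y) : Integrable (fun p : X × Y ↦ centredDist (θ.map Prod.snd) p.2 y) θ :=
    .of_bound (hm y).aestronglyMeasurable _ (.of_forall (hb y))
  refine (Measure.prod_eq fun A B hA hB ↦ ?_).symm
  have hA' : MeasurableSet (Prod.fst ⁻¹' A : Set (X × Y)) := measurable_fst hA
  have hfst (y : Y) : ∫ p in Prod.fst ⁻¹' A, centredDist (θ.map Prod.snd) p.2 y ∂θ = 0 :=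
    hX.setIntegral_preimage_eq_zero measurable_fst hμ (hm y) (hb y) (h0 y)
      (fun x ↦ h (x, y)) hA
  let c := θ.real (Prod.fst ⁻¹' A)
  have hsnd := hY.setIntegral_preimage_eq_zero (P := θ) measurable_snd hν
    (g := fun p ↦ (Prod.fst ⁻¹' A).indicator 1 p - c)
    (C := 1 + |c|) ((measurable_one.indicator hA').sub_const c)
    (fun p ↦ (abs_sub _ _).trans <| by
      gcongr
      by_cases hp : p ∈ (Prod.fst ⁻¹' A : Set (X × Y)) <;> simp [hp])
    (by
      rw [integral_sub ((integrable_const 1).indicator hA') (integrable_const _),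
        integral_indicator_one hA']
      simp [c])
    (fun y ↦ by
      have hind : ∀ p : X × Y, centredDist (θ.map Prod.snd) p.2 y *
          ((Prod.fst ⁻¹' A).indicator 1 p - c) =
          (Prod.fst ⁻¹' A).indicator (fun p ↦ centredDist (θ.map Prod.snd) p.2 y) p -
            c * centredDist (θ.map Prod.snd) p.2 y := fun p ↦ by
        by_cases hp : p ∈ (Prod.fst ⁻¹' A : Set (X × Y))
        · simp only [Set.indicator_of_mem hp, Pi.one_apply]; ring
        · simp only [Set.indicator_of_notMem hp]; ring
      simp_rw [hind]
      rw [integral_sub ((hi y).indicator hA') ((hi y).const_mul c), integral_indicator hA',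
        hfst, integral_const_mul, h0]
      simp) hB
  rw [integral_sub ((integrable_const 1).indicator hA') (integrable_const _),
    integral_indicator_one hA'] at hsnd
  rw [Measure.map_apply measurable_fst hA, Measure.map_apply measurable_snd hB, Set.prod_eq,
    ← ofReal_measureReal, ← ofReal_measureReal (μ := θ) (s := Prod.fst ⁻¹' A),
    ← ofReal_measureReal (μ := θ) (s := Prod.snd ⁻¹' B), ← ENNReal.ofReal_mul (by positivity)]
  congr 1
  rw [measureReal_restrict_apply hA'] at hsnd
  simp [c] at hsnd
  linarith

/-- If `X` and `Y` are separable metric spaces of strong negative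
type, then for every Borel probability measure `θ` on `X × Y` whose marginals have
finite first moments, `dcov(θ) ≥ 0` and `dcov(θ) = 0` iff `θ` is the product of its
marginals; in particular, for random elements `f ∼ μ`, `g ∼ ν` with joint
distribution `θ`, `dcov = 0` iff `f` and `g` are independent. -/
theorem dcov_eq_zero_iff_indep_of_strongNegativeType
    {X Y : Type*} [MetricSpace X] [MetricSpace Y]
    [TopologicalSpace.SeparableSpace X] [TopologicalSpace.SeparableSpace Y]
    [MeasurableSpace X] [BorelSpace X] [MeasurableSpace Y] [BorelSpace Y]
    (hX : StrongNegativeType X) (hY : StrongNegativeType Y)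
    (θ : Measure (X × Y)) [IsProbabilityMeasure θ]
    (hμ : ∃ o : X, Integrable (fun x => dist o x) (θ.map Prod.fst))
    (hν : ∃ o : Y, Integrable (fun y => dist o y) (θ.map Prod.snd)) :
    0 ≤ dcov θ ∧
    (dcov θ = 0 ↔ θ = (θ.map Prod.fst).prod (θ.map Prod.snd)) ∧
    (∀ (Ω : Type*) (_ : MeasurableSpace Ω) (P : Measure Ω), IsProbabilityMeasure P →
      ∀ f : Ω → X, ∀ g : Ω → Y, Measurable f → Measurable g →
        P.map (fun ω => (f ω, g ω)) = θ →
        (dcov θ = 0 ↔ ProbabilityTheory.IndepFun f g P)) := by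
  have := Measure.isProbabilityMeasure_map (μ := θ) measurable_fst.aemeasurable
  have := Measure.isProbabilityMeasure_map (μ := θ) measurable_snd.aemeasurable
  obtain ⟨H, _, _, _, F, hF, hF0, hFin⟩ := hX.1.exists_tensor_embedding hY.1 θ hμ hν
  have hd : dcov θ = ‖∫ p, F p ∂θ‖ ^ 2 := by
    rw [← integral_inner_prod_self hF]
    simp only [dcov, hFin]
  have hiff : dcov θ = 0 ↔ θ = (θ.map Prod.fst).prod (θ.map Prod.snd) := by
    refine ⟨fun h ↦ ?_, fun h ↦ by simp [hd, hF0 h]⟩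
    have h0 : ∫ p, F p ∂θ = 0 := by simpa [hd] using h
    refine eq_prod_of_integral_centredDist_mul_eq_zero hX hY θ hμ hν fun q ↦ ?_
    simp_rw [← hFin, real_inner_comm (F q)]
    rw [integral_inner hF, h0, inner_zero_right]
  refine ⟨hd ▸ sq_nonneg _, hiff, fun Ω _ P _ f g hf hg hfg ↦ ?_⟩
  have h1 : θ.map Prod.fst = P.map f := by
    rw [← hfg, Measure.map_map measurable_fst (hf.prodMk hg)]
    rfl
  have h2 : θ.map Prod.snd = P.map g := by
    rw [← hfg, Measure.map_map measurable_snd (hf.prodMk hg)]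
    rfl
  rw [hiff, ProbabilityTheory.indepFun_iff_map_prod_eq_prod_map_map hf.aemeasurable
    hg.aemeasurable, hfg, h1, h2]
end

section
/- Every separable real Hilbert space H, equipped with the metric d(x,y) := ‖x − y‖, has strong negative type: it has negative type, and for any two Borel probability measures μ₁, μ₂ on H with finite first moments, D(μ₁ − μ₂) = 0 implies μ₁ = μ₂. -/
open MeasureTheory

universe u

theorem Matrix.posSemidef_inner {ι E : Type*} [NormedAddCommGroup E] [InnerProductSpace ℝ E]
    (v : ι → E) : (Matrix.of fun i j ↦ inner ℝ (v i) (v j)).PosSemidef := by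
  refine ⟨?_, fun c ↦ ?_⟩
  · ext i j
    simp [real_inner_comm]
  · have h : (c.sum fun i a ↦ c.sum fun j b ↦ star a * inner ℝ (v i) (v j) * b) =
        inner ℝ (c.sum fun i a ↦ a • v i) (c.sum fun i a ↦ a • v i) := by
      simp only [Finsupp.sum, sum_inner, inner_sum, real_inner_smul_left, real_inner_smul_right,
        star_trivial]
      exact Finset.sum_congr rfl fun i _ ↦ Finset.sum_congr rfl fun j _ ↦ by
        rw [real_inner_comm]; ring
    simpa only [Matrix.of_apply, h] using real_inner_self_nonneg

theorem Matrix.PosSemidef.hadamard_pow {ι : Type*} {A : Matrix ι ι ℝ} (hA : A.PosSemidef) (n : ℕ) :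
    (A.map (· ^ n)).PosSemidef := by
  induction n with
  | zero =>
    convert! Matrix.posSemidef_inner (fun _ : ι ↦ (1 : ℝ)) using 1
    ext i j
    simp
  | succ n ih =>
    convert! ih.hadamard hA using 1

theorem Matrix.PosSemidef.hadamard_exp {ι : Type*} {A : Matrix ι ι ℝ} (hA : A.PosSemidef) :
    (A.map Real.exp).PosSemidef := by
  refine ⟨hA.1.map _ fun _ ↦ rfl, fun c ↦ ?_⟩
  have hlim (i j : ι) : Filter.Tendsto (fun N ↦ ∑ n ∈ Finset.range N, A i j ^ n / (n.factorial : ℝ))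
      Filter.atTop (nhds (Real.exp (A i j))) := by
    rw [Real.exp_eq_exp_ℝ]
    exact (NormedSpace.expSeries_div_hasSum_exp (A i j)).tendsto_sum_nat
  refine ge_of_tendsto' (tendsto_finsetSum _ fun i _ ↦ tendsto_finsetSum _ fun j _ ↦
    ((hlim i j).const_mul (star (c i))).mul_const (c j)) fun N ↦ ?_
  have h : ∑ i ∈ c.support, ∑ j ∈ c.support,
      star (c i) * (∑ n ∈ Finset.range N, A i j ^ n / (n.factorial : ℝ)) * c j =
      ∑ n ∈ Finset.range N, (n.factorial : ℝ)⁻¹ *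
        c.sum fun i a ↦ c.sum fun j b ↦ star a * A.map (· ^ n) i j * b := by
    simp only [Finsupp.sum, Finset.mul_sum, Finset.sum_mul, Matrix.map_apply]
    symm
    rw [Finset.sum_comm]
    refine Finset.sum_congr rfl fun i _ ↦ ?_
    rw [Finset.sum_comm]
    exact Finset.sum_congr rfl fun j _ ↦ Finset.sum_congr rfl fun n _ ↦ by ring
  rw [h]
  exact Finset.sum_nonneg fun n _ ↦ mul_nonneg (by positivity) ((hA.hadamard_pow n).2 c)

theorem Matrix.posSemidef_gaussian (E : Type*) [NormedAddCommGroup E] [InnerProductSpace ℝ E] :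
    (Matrix.of fun x y : E ↦ Real.exp (-‖x - y‖ ^ 2)).PosSemidef := by
  convert! (Matrix.posSemidef_inner fun x : E ↦ Real.exp (-‖x‖ ^ 2)).hadamard
    ((Matrix.posSemidef_inner fun x : E ↦ x).smul (zero_le_two (α := ℝ))).hadamard_exp using 1
  ext x y
  simp only [Matrix.of_apply, Matrix.hadamard_apply, Matrix.map_apply, Matrix.smul_apply,
    norm_sub_sq_real, RCLike.inner_apply, conj_trivial, ← Real.exp_add, smul_eq_mul]
  ring_nf

theorem Matrix.PosSemidef.exists_featureMap {X : Type u} {K : Matrix X X ℝ} (hK : K.PosSemidef) :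
    ∃ (F : Type u) (_ : NormedAddCommGroup F) (_ : InnerProductSpace ℝ F) (_ : CompleteSpace F)
      (φ : X → F), ∀ x y, inner ℝ (φ x) (φ y) = K x y := by
  let L : Matrix X X (ℝ →L[ℝ] ℝ) := K.map fun a ↦ a • ContinuousLinearMap.id ℝ ℝ
  have hL : L.PosSemidef := by
    have h := (RKHS.posSemidef_tfae (K := L)).out 0 2
    refine h.mpr ⟨?_, fun c ↦ ?_⟩
    · ext i j
      simpa [L, ContinuousLinearMap.star_eq_adjoint, -ContinuousLinearMap.coe_id',
        ContinuousLinearMap.adjoint_id] using hK.1.apply i j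
    · convert! hK.2 c using 1
      simp only [L, Matrix.map_apply, RCLike.inner_apply,
        conj_trivial, RCLike.re_to_real, star_trivial]
      refine Finsupp.sum_congr fun i _ ↦ Finsupp.sum_congr fun j _ ↦ ?_
      rw [← hK.1.apply j i, star_trivial, _root_.smul_apply,
        ContinuousLinearMap.id_apply, smul_eq_mul]
      ring
  have : Fact L.PosSemidef := ⟨hL⟩
  refine ⟨RKHS.OfKernel L, inferInstance, inferInstance, inferInstance,
    fun x ↦ RKHS.kerFun (RKHS.OfKernel L) x 1, fun x y ↦ ?_⟩
  rw [← RKHS.kernel_inner, RKHS.OfKernel.kernel_ofKernel]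
  simpa [L] using hK.1.apply x y

theorem one_sub_exp_div_sq_nonneg (s r : ℝ) : 0 ≤ (1 - Real.exp (-(s * r) ^ 2)) / s ^ 2 :=
  div_nonneg (sub_nonneg.mpr (Real.exp_le_one_iff.mpr (neg_nonpos.mpr (sq_nonneg _)))) (sq_nonneg _)

theorem integrable_one_sub_exp_div_sq (r : ℝ) :
    Integrable fun s : ℝ ↦ (1 - Real.exp (-(s * r) ^ 2)) / s ^ 2 := by
  refine (integrable_inv_one_add_sq.const_mul (1 + r ^ 2)).mono'
    (Measurable.aestronglyMeasurable (by fun_prop)) (.of_forall fun s ↦ ?_)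
  rw [Real.norm_of_nonneg (one_sub_exp_div_sq_nonneg s r)]
  have h₁ := Real.add_one_le_exp (-(s * r) ^ 2)
  have h₂ := Real.exp_pos (-(s * r) ^ 2)
  rcases eq_or_ne s 0 with rfl | hs
  · simp; positivity
  · rw [← div_eq_mul_inv, div_le_div_iff₀ (by positivity) (by positivity)]
    nlinarith [sq_nonneg s]

theorem integral_one_sub_exp_div_sq {r : ℝ} (hr : 0 ≤ r) :
    ∫ s : ℝ, (1 - Real.exp (-(s * r) ^ 2)) / s ^ 2 =
      r * ∫ s : ℝ, (1 - Real.exp (-s ^ 2)) / s ^ 2 := by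
  rcases hr.eq_or_lt with rfl | hr
  · simp
  · have h (s : ℝ) : (1 - Real.exp (-(s * r) ^ 2)) / s ^ 2 =
        r ^ 2 * ((1 - Real.exp (-(s * r) ^ 2)) / (s * r) ^ 2) := by
      rcases eq_or_ne s 0 with rfl | hs
      · simp
      · field_simp
    simp_rw [h]
    rw [integral_const_mul, Measure.integral_comp_mul_right
      (fun s : ℝ ↦ (1 - Real.exp (-s ^ 2)) / s ^ 2), abs_of_pos (inv_pos.mpr hr), smul_eq_mul]
    field_simp

theorem integral_one_sub_exp_div_sq_pos : 0 < ∫ s : ℝ, (1 - Real.exp (-s ^ 2)) / s ^ 2 := by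
  rw [integral_pos_iff_support_of_nonneg
    (fun s ↦ by simpa using one_sub_exp_div_sq_nonneg s 1)
    (by simpa using integrable_one_sub_exp_div_sq 1)]
  refine lt_of_lt_of_le (b := volume (Set.Ioi (0 : ℝ))) (by simp) (measure_mono fun s hs ↦ ?_)
  have hs : 0 < s := hs
  have h : Real.exp (-s ^ 2) < 1 := Real.exp_lt_one_iff.mpr (neg_neg_of_pos (by positivity))
  exact (div_pos (sub_pos.mpr h) (by positivity)).ne'

section GaussianFeatureMap

variable {H F : Type*} [NormedAddCommGroup H] [NormedAddCommGroup F]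
  [InnerProductSpace ℝ F] {φ : H → F}

theorem norm_featureMap (hφ : ∀ x y, inner ℝ (φ x) (φ y) = Real.exp (-‖x - y‖ ^ 2)) (x : H) :
    ‖φ x‖ = 1 := by
  rw [norm_eq_sqrt_real_inner, hφ]
  simp

theorem continuous_featureMap (hφ : ∀ x y, inner ℝ (φ x) (φ y) = Real.exp (-‖x - y‖ ^ 2)) :
    Continuous φ := by
  refine continuous_iff_continuousAt.mpr fun y ↦ tendsto_iff_norm_sub_tendsto_zero.mpr ?_
  have h (x : H) : ‖φ x - φ y‖ = Real.sqrt (2 - 2 * Real.exp (-‖x - y‖ ^ 2)) := by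
    rw [← Real.sqrt_sq (norm_nonneg (φ x - φ y)), norm_sub_sq_real, norm_featureMap hφ,
      norm_featureMap hφ, hφ]
    ring_nf
  simp_rw [h]
  have hc : Continuous fun x : H ↦ Real.sqrt (2 - 2 * Real.exp (-‖x - y‖ ^ 2)) := by fun_prop
  simpa using hc.tendsto y

variable [InnerProductSpace ℝ H]

theorem inner_featureMap_smul (hφ : ∀ x y, inner ℝ (φ x) (φ y) = Real.exp (-‖x - y‖ ^ 2))
    (s : ℝ) (x y : H) : inner ℝ (φ (s • x)) (φ (s • y)) = Real.exp (-(s * ‖x - y‖) ^ 2) := by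
  rw [hφ, ← smul_sub, norm_smul, mul_pow, mul_pow, Real.norm_eq_abs, sq_abs]

theorem negativeType_of_featureMap
    (hφ : ∀ x y, inner ℝ (φ x) (φ y) = Real.exp (-‖x - y‖ ^ 2))
    {n : ℕ} (x : Fin n → H) (α : Fin n → ℝ) (hα : ∑ i, α i = 0) :
    ∑ i, ∑ j, α i * α j * dist (x i) (x j) ≤ 0 := by
  refine nonpos_of_mul_nonpos_left ?_ integral_one_sub_exp_div_sq_pos
  have h (s : ℝ) : ∑ i, ∑ j, α i * α j * ((1 - Real.exp (-(s * ‖x i - x j‖) ^ 2)) / s ^ 2) =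
      -(‖∑ i, α i • φ (s • x i)‖ ^ 2 / s ^ 2) := by
    rw [← real_inner_self_eq_norm_sq]
    simp only [sum_inner, inner_sum, real_inner_smul_left, real_inner_smul_right,
      inner_featureMap_smul hφ]
    have h₀ : ∑ i, ∑ j, α i * α j = 0 := by rw [← Finset.sum_mul_sum, hα, zero_mul]
    have h₁ : ∑ i, ∑ j, α i * α j * ((1 - Real.exp (-(s * ‖x i - x j‖) ^ 2)) / s ^ 2) =
        (∑ i, ∑ j, α i * α j) / s ^ 2 -
          (∑ i, ∑ j, α i * (α j * Real.exp (-(s * ‖x i - x j‖) ^ 2))) / s ^ 2 := by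
      simp only [Finset.sum_div, ← Finset.sum_sub_distrib]
      exact Finset.sum_congr rfl fun i _ ↦ Finset.sum_congr rfl fun j _ ↦ by ring
    rw [h₁, h₀, zero_div, zero_sub]
    congr! 6 with i _ j _
    rw [norm_sub_rev]
  calc (∑ i, ∑ j, α i * α j * dist (x i) (x j)) * ∫ s : ℝ, (1 - Real.exp (-s ^ 2)) / s ^ 2
      = ∫ s : ℝ, ∑ i, ∑ j, α i * α j * ((1 - Real.exp (-(s * ‖x i - x j‖) ^ 2)) / s ^ 2) := by
        rw [integral_finsetSum _ fun i _ ↦ integrable_finsetSum _ fun j _ ↦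
          (integrable_one_sub_exp_div_sq _).const_mul _]
        simp_rw [integral_finsetSum _ fun j _ ↦ (integrable_one_sub_exp_div_sq _).const_mul _,
          integral_const_mul, integral_one_sub_exp_div_sq (norm_nonneg _), Finset.sum_mul,
          dist_eq_norm, mul_assoc]
    _ ≤ 0 := by
        simp_rw [h]
        exact integral_nonpos fun s ↦ neg_nonpos.mpr (by positivity)

variable [MeasurableSpace H] [BorelSpace H] [SecondCountableTopology H]

theorem integrable_featureMap_smul
    (hφ : ∀ x y, inner ℝ (φ x) (φ y) = Real.exp (-‖x - y‖ ^ 2))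
    (μ : Measure H) [IsFiniteMeasure μ] (s : ℝ) : Integrable (fun x ↦ φ (s • x)) μ :=
  .of_bound ((continuous_featureMap hφ).comp (continuous_const_smul s)).aestronglyMeasurable 1
    (.of_forall fun _ ↦ (norm_featureMap hφ _).le)

variable [CompleteSpace F]

theorem integral_exp_neg_sq_eq_inner
    (hφ : ∀ x y, inner ℝ (φ x) (φ y) = Real.exp (-‖x - y‖ ^ 2))
    (μ ν : Measure H) [IsFiniteMeasure μ] [IsFiniteMeasure ν] (s : ℝ) :
    ∫ p : H × H, Real.exp (-(s * ‖p.1 - p.2‖) ^ 2) ∂(μ.prod ν) =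
      inner ℝ (∫ x, φ (s • x) ∂μ) (∫ x, φ (s • x) ∂ν) := by
  rw [integral_prod]
  · simp_rw [← inner_featureMap_smul hφ, integral_inner (integrable_featureMap_smul hφ ν s),
      real_inner_comm (∫ x, φ (s • x) ∂ν), integral_inner (integrable_featureMap_smul hφ μ s)]
  · refine .of_bound (by fun_prop) 1 (.of_forall fun p ↦ ?_)
    simpa using sq_nonneg _

theorem integral_dist_mul_eq_integral_inner
    (hφ : ∀ x y, inner ℝ (φ x) (φ y) = Real.exp (-‖x - y‖ ^ 2))
    (μ ν : Measure H) [IsProbabilityMeasure μ] [IsProbabilityMeasure ν]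
    (hd : Integrable (fun p : H × H ↦ dist p.1 p.2) (μ.prod ν)) :
    Integrable (fun s : ℝ ↦
      (1 - inner ℝ (∫ x, φ (s • x) ∂μ) (∫ x, φ (s • x) ∂ν)) / s ^ 2) ∧
    (∫ x, ∫ y, dist x y ∂ν ∂μ) * ∫ s : ℝ, (1 - Real.exp (-s ^ 2)) / s ^ 2 =
      ∫ s : ℝ, (1 - inner ℝ (∫ x, φ (s • x) ∂μ) (∫ x, φ (s • x) ∂ν)) / s ^ 2 := by
  have hInt : Integrable (Function.uncurry fun (p : H × H) (s : ℝ) ↦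
      (1 - Real.exp (-(s * ‖p.1 - p.2‖) ^ 2)) / s ^ 2) ((μ.prod ν).prod volume) := by
    rw [integrable_prod_iff (Measurable.aestronglyMeasurable
      (by unfold Function.uncurry; fun_prop))]
    refine ⟨.of_forall fun p ↦ integrable_one_sub_exp_div_sq ‖p.1 - p.2‖, ?_⟩
    simp only [Function.uncurry, Real.norm_of_nonneg (one_sub_exp_div_sq_nonneg _ _),
      integral_one_sub_exp_div_sq (norm_nonneg _)]
    simpa only [dist_eq_norm] using hd.mul_const _
  have hs (s : ℝ) : ∫ p : H × H, (1 - Real.exp (-(s * ‖p.1 - p.2‖) ^ 2)) / s ^ 2 ∂(μ.prod ν) =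
      (1 - inner ℝ (∫ x, φ (s • x) ∂μ) (∫ x, φ (s • x) ∂ν)) / s ^ 2 := by
    rw [integral_div, integral_sub (integrable_const _), integral_exp_neg_sq_eq_inner hφ]
    · simp
    · refine .of_bound (by fun_prop) 1 (.of_forall fun p ↦ ?_)
      simpa using sq_nonneg _
  simp_rw [← hs]
  refine ⟨hInt.integral_prod_right, ?_⟩
  rw [← integral_integral_swap hInt, integral_integral hd, ← integral_mul_const]
  simp_rw [integral_one_sub_exp_div_sq (norm_nonneg _), dist_eq_norm]

end GaussianFeatureMap

theorem integrable_dist_prod {X : Type*} [MetricSpace X] [MeasurableSpace X] [BorelSpace X]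
    [SecondCountableTopology X] {μ ν : Measure X} [IsFiniteMeasure μ] [IsFiniteMeasure ν]
    {a b : X} (hμ : Integrable (fun x ↦ dist a x) μ) (hν : Integrable (fun x ↦ dist b x) ν) :
    Integrable (fun p : X × X ↦ dist p.1 p.2) (μ.prod ν) := by
  refine (((hμ.comp_fst ν).add (hν.comp_snd μ)).add (integrable_const (dist a b))).mono'
    (by fun_prop) (.of_forall fun p ↦ ?_)
  rw [Real.norm_of_nonneg dist_nonneg]
  simp only [Pi.add_apply]
  linarith [dist_triangle4 p.1 a b p.2, dist_comm p.1 a]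

theorem MeasureTheory.Measure.ext_of_integral_gaussian {H : Type*} [NormedAddCommGroup H]
    [InnerProductSpace ℝ H] [CompleteSpace H] [SecondCountableTopology H] [MeasurableSpace H]
    [BorelSpace H] {μ ν : Measure H} [IsProbabilityMeasure μ] [IsProbabilityMeasure ν] {s : ℝ}
    (hs : s ≠ 0) (h : ∀ v, ∫ x, Real.exp (-(s * ‖x - v‖) ^ 2) ∂μ =
      ∫ x, Real.exp (-(s * ‖x - v‖) ^ 2) ∂ν) : μ = ν := by
  let f : H → ENNReal := fun x ↦ ENNReal.ofReal (Real.exp (-(s * ‖x‖) ^ 2))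
  have hf : Measurable f := by fun_prop
  have hf0 (x : H) : f x ≠ 0 := by simpa [f] using Real.exp_pos _
  have hft (x : H) : f x ≠ ⊤ := ENNReal.ofReal_ne_top
  have hfin (ρ : Measure H) [IsProbabilityMeasure ρ] : IsFiniteMeasure (ρ.withDensity f) := by
    refine isFiniteMeasure_withDensity_ofReal (Integrable.of_bound (by fun_prop) 1
      (.of_forall fun x ↦ ?_)).2
    simpa using sq_nonneg _
  have := hfin μ
  have := hfin ν
  have hexp (u x : H) : Real.exp (-(s * ‖x‖) ^ 2) * Real.exp (inner ℝ x u) =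
      Real.exp (‖(2 * s)⁻¹ • u‖ ^ 2) * Real.exp (-(s * ‖x - (2 * s ^ 2)⁻¹ • u‖) ^ 2) := by
    rw [← Real.exp_add, ← Real.exp_add, mul_pow _ ‖x - _‖, norm_sub_sq_real, norm_smul, norm_smul,
      real_inner_smul_right, mul_pow ‖_‖, mul_pow ‖_‖, Real.norm_eq_abs, Real.norm_eq_abs,
      sq_abs, sq_abs]
    congr 1
    field_simp
    ring
  have hintegral (ρ : Measure H) [IsProbabilityMeasure ρ] (u : H) :
      ∫ x, Real.exp (inner ℝ x u) ∂(ρ.withDensity f) = Real.exp (‖(2 * s)⁻¹ • u‖ ^ 2) *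
        ∫ x, Real.exp (-(s * ‖x - (2 * s ^ 2)⁻¹ • u‖) ^ 2) ∂ρ := by
    rw [integral_withDensity_eq_integral_toReal_smul hf (.of_forall fun x ↦ (hft x).lt_top),
      ← integral_const_mul]
    simp_rw [← hexp, f, ENNReal.toReal_ofReal (Real.exp_pos _).le, smul_eq_mul]
  have hintegrable (ρ : Measure H) [IsProbabilityMeasure ρ] (u : H) :
      Integrable (fun x ↦ Real.exp (inner ℝ x u)) (ρ.withDensity f) := by
    rw [integrable_withDensity_iff_integrable_smul' hf (.of_forall fun x ↦ (hft x).lt_top)]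
    simp_rw [f, ENNReal.toReal_ofReal (Real.exp_pos _).le, smul_eq_mul, hexp]
    refine (Integrable.of_bound (by fun_prop) 1 (.of_forall fun x ↦ ?_)).const_mul _
    simpa using sq_nonneg _
  have hset (ρ : Measure H) [IsProbabilityMeasure ρ] (u : H) :
      ProbabilityTheory.integrableExpSet (fun x ↦ inner ℝ x u) (ρ.withDensity f) = Set.univ := by
    refine Set.eq_univ_of_forall fun t ↦ ?_
    simpa [ProbabilityTheory.integrableExpSet, real_inner_smul_right] using hintegrable ρ (t • u)
  have hmgf (u : H) : ProbabilityTheory.mgf (fun x ↦ inner ℝ x u) (μ.withDensity f) =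
      ProbabilityTheory.mgf (fun x ↦ inner ℝ x u) (ν.withDensity f) := by
    ext t
    simp_rw [ProbabilityTheory.mgf, ← real_inner_smul_right, hintegral, h]
  have hne (ρ : Measure H) [IsProbabilityMeasure ρ] : ρ.withDensity f ≠ 0 := by
    rw [Ne, withDensity_eq_zero_iff hf.aemeasurable]
    intro h0
    obtain ⟨x, hx⟩ := h0.exists
    exact hf0 x hx
  have heq : μ.withDensity f = ν.withDensity f := by
    refine Measure.ext_of_charFun (funext fun u ↦ ?_)
    have := ProbabilityTheory.eqOn_complexMGF_of_mgf' (hmgf u) (by simp [hne])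
      (x := Complex.I) (by simp [hset])
    simpa [ProbabilityTheory.complexMGF, charFun_apply, mul_comm] using this
  rw [← withDensity_inv_same hf (μ := μ) (.of_forall hf0) (.of_forall hft), heq,
    withDensity_inv_same hf (.of_forall hf0) (.of_forall hft)]

theorem integral_featureMap_eq_of_measureD_eq {H F : Type*} [NormedAddCommGroup H]
    [InnerProductSpace ℝ H] [MeasurableSpace H] [BorelSpace H] [SecondCountableTopology H]
    [NormedAddCommGroup F] [InnerProductSpace ℝ F] [CompleteSpace F] {φ : H → F}
    (hφ : ∀ x y, inner ℝ (φ x) (φ y) = Real.exp (-‖x - y‖ ^ 2))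
    {μ ν : Measure H} [IsProbabilityMeasure μ] [IsProbabilityMeasure ν] {a b : H}
    (hμ : Integrable (fun x ↦ dist a x) μ) (hν : Integrable (fun x ↦ dist b x) ν)
    (hD : measureD μ + measureD ν - 2 * (∫ x, ∫ y, dist x y ∂ν ∂μ) = 0) :
    ∃ s : ℝ, s ≠ 0 ∧ ∫ x, φ (s • x) ∂μ = ∫ x, φ (s • x) ∂ν := by
  obtain ⟨hi₁, he₁⟩ := integral_dist_mul_eq_integral_inner hφ μ μ (integrable_dist_prod hμ hμ)
  obtain ⟨hi₂, he₂⟩ := integral_dist_mul_eq_integral_inner hφ ν ν (integrable_dist_prod hν hν)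
  obtain ⟨hi, he⟩ := integral_dist_mul_eq_integral_inner hφ μ ν (integrable_dist_prod hμ hν)
  have hsq : (fun s : ℝ ↦ ‖∫ x, φ (s • x) ∂μ - ∫ x, φ (s • x) ∂ν‖ ^ 2 / s ^ 2) = fun s ↦
      2 * ((1 - inner ℝ (∫ x, φ (s • x) ∂μ) (∫ x, φ (s • x) ∂ν)) / s ^ 2) -
        ((1 - inner ℝ (∫ x, φ (s • x) ∂μ) (∫ x, φ (s • x) ∂μ)) / s ^ 2 +
        (1 - inner ℝ (∫ x, φ (s • x) ∂ν) (∫ x, φ (s • x) ∂ν)) / s ^ 2) := by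
    ext s
    rw [norm_sub_sq_real, ← real_inner_self_eq_norm_sq, ← real_inner_self_eq_norm_sq]
    ring
  have hInt : Integrable fun s : ℝ ↦
      ‖∫ x, φ (s • x) ∂μ - ∫ x, φ (s • x) ∂ν‖ ^ 2 / s ^ 2 := by
    rw [hsq]
    exact (hi.const_mul 2).sub (hi₁.add hi₂)
  have hzero : ∫ s : ℝ, ‖∫ x, φ (s • x) ∂μ - ∫ x, φ (s • x) ∂ν‖ ^ 2 / s ^ 2 = 0 := by
    rw [hsq, integral_sub (hi.const_mul 2) (hi₁.fun_add hi₂), integral_const_mul,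
      integral_add hi₁ hi₂, ← he, ← he₁, ← he₂]
    unfold measureD at hD
    linear_combination (-∫ s : ℝ, (1 - Real.exp (-s ^ 2)) / s ^ 2) * hD
  rw [integral_eq_zero_iff_of_nonneg (fun s ↦ by positivity) hInt] at hzero
  obtain ⟨s, hs, hs₀⟩ := (hzero.and (Measure.ae_ne volume (0 : ℝ))).exists
  refine ⟨s, hs₀, ?_⟩
  simpa [hs₀, sub_eq_zero] using hs

/-- Every separable real Hilbert space, with the metric
`d(x,y) = ‖x − y‖`, has strong negative type: it has negative type, and `D`
separates Borel probability measures with finite first moments. -/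
theorem separable_hilbert_strongNegativeType
    {H : Type*} [NormedAddCommGroup H] [InnerProductSpace ℝ H] [CompleteSpace H]
    [TopologicalSpace.SeparableSpace H]
    [MeasurableSpace H] [BorelSpace H] :
    NegativeType H ∧
      ∀ μ₁ μ₂ : Measure H, IsProbabilityMeasure μ₁ → IsProbabilityMeasure μ₂ →
        (∃ o : H, Integrable (fun x => dist o x) μ₁) →
        (∃ o : H, Integrable (fun x => dist o x) μ₂) →
        measureD μ₁ + measureD μ₂ - 2 * (∫ x, ∫ x', dist x x' ∂μ₂ ∂μ₁) = 0 →
        μ₁ = μ₂ := by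
  have : SecondCountableTopology H := UniformSpace.secondCountable_of_separable H
  obtain ⟨F, _, _, _, φ, hφ⟩ := (Matrix.posSemidef_gaussian H).exists_featureMap
  refine ⟨fun n _ x α hα ↦ negativeType_of_featureMap hφ x α hα, ?_⟩
  rintro μ₁ μ₂ _ _ ⟨a, hμ₁⟩ ⟨b, hμ₂⟩ hD
  obtain ⟨s, hs, h⟩ := integral_featureMap_eq_of_measureD_eq hφ hμ₁ hμ₂ hD
  refine Measure.ext_of_integral_gaussian hs fun v ↦ ?_
  simp_rw [← inner_featureMap_smul hφ, real_inner_comm (φ (s • v)),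
    integral_inner (integrable_featureMap_smul hφ _ s), h]
end
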